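/- Let R be a Rota-Baxter family Hom-associative algebra of weight λ, let Ω(R,V) be a Rota-Baxter family Hom extending structure of R through a k-vector space V, and let d : V → R be a deformation map of Ω(R,V). Define a new multiplication on V by x ·_d y := x ·_V y + d(x)▷y + x◁d(y) for all x, y ∈ V. Then V_d := (V, ·_d, (P_{ω,V})_{ω∈S}, θ_V) is a Rota-Baxter family Hom-associative algebra of weight λ (the deformation of V). -/

import Mathlib

/-- The data of a Rota-Baxter family Hom-associative algebra: a bilinear
multiplication, a family of linear operators indexed by a semigroup `S`,
and a linear twisting map. -/
structure RBFData (k S R : Type*) [Field k] [Semigroup S]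
    [AddCommGroup R] [Module k R] where
  mul : R →ₗ[k] R →ₗ[k] R
  P : S → R →ₗ[k] R
  theta : R →ₗ[k] R

/-- The axioms of a Rota-Baxter family Hom-associative algebra of weight `lam`,
stated for arbitrary operations. -/
def IsRBFOps {k S M : Type*} [Field k] [Semigroup S] [AddCommGroup M] [Module k M]
    (lam : k) (mul : M → M → M) (P : S → M → M) (theta : M → M) : Prop :=
  (∀ x y z : M, mul (theta x) (mul y z) = mul (mul x y) (theta z)) ∧
  (∀ (α β : S) (x y : M), mul (P α x) (P β y)
      = P (α * β) (mul (P α x) y + mul x (P β y) + lam • mul x y)) ∧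
  (∀ (ω : S) (x : M), P ω (theta x) = theta (P ω x))

/-- `(R, ·, (P_ω), θ)` is a Rota-Baxter family Hom-associative algebra of weight `lam`. -/
def RBFData.IsRBF {k S R : Type*} [Field k] [Semigroup S] [AddCommGroup R] [Module k R]
    (A : RBFData k S R) (lam : k) : Prop :=
  IsRBFOps lam (fun x y => A.mul x y) (fun ω x => A.P ω x) (fun x => A.theta x)

/-- An extending datum `Ω(R,V)` of `R` through `V`:
`dR` is `▷ : R×V→V`, `dL` is `◁ : V×R→V`, `hR` is `⇀ : V×R→R`, `hL` is `↼ : R×V→R`,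
`f : V×V→R` is the cocycle, `mulV : V×V→V`, and the linear maps
`Q_ω : V→R`, `PV_ω : V→V`, `eta : V→R`, `thetaV : V→V`. -/
structure ExtDatum (k S R V : Type*) [Field k] [Semigroup S]
    [AddCommGroup R] [Module k R] [AddCommGroup V] [Module k V] where
  dR : R →ₗ[k] V →ₗ[k] V
  dL : V →ₗ[k] R →ₗ[k] V
  hR : V →ₗ[k] R →ₗ[k] R
  hL : R →ₗ[k] V →ₗ[k] R
  f : V →ₗ[k] V →ₗ[k] R
  mulV : V →ₗ[k] V →ₗ[k] V
  Q : S → V →ₗ[k] R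
  PV : S → V →ₗ[k] V
  eta : V →ₗ[k] R
  thetaV : V →ₗ[k] V

/-- The multiplication of the (prospective) unified product `R ♮ V`. -/
def natMul {k S R V : Type*} [Field k] [Semigroup S]
    [AddCommGroup R] [Module k R] [AddCommGroup V] [Module k V]
    (A : RBFData k S R) (D : ExtDatum k S R V) : R × V → R × V → R × V := fun p q =>
  (A.mul p.1 q.1 + D.hL p.1 q.2 + D.hR p.2 q.1 + D.f p.2 q.2,
   D.dR p.1 q.2 + D.dL p.2 q.1 + D.mulV p.2 q.2)

/-- The Rota-Baxter family of the (prospective) unified product `R ♮ V`. -/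
def natP {k S R V : Type*} [Field k] [Semigroup S]
    [AddCommGroup R] [Module k R] [AddCommGroup V] [Module k V]
    (A : RBFData k S R) (D : ExtDatum k S R V) : S → R × V → R × V := fun ω p =>
  (A.P ω p.1 + D.Q ω p.2, D.PV ω p.2)

/-- The twisting map of the (prospective) unified product `R ♮ V`. -/
def natTheta {k S R V : Type*} [Field k] [Semigroup S]
    [AddCommGroup R] [Module k R] [AddCommGroup V] [Module k V]
    (A : RBFData k S R) (D : ExtDatum k S R V) : R × V → R × V := fun p =>
  (A.theta p.1 + D.eta p.2, D.thetaV p.2)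

/-- An extending datum is a Rota-Baxter family Hom extending structure when the
unified product `R ♮ V` is a Rota-Baxter family Hom-associative algebra of weight `lam`. -/
def IsExtendingStructure {k S R V : Type*} [Field k] [Semigroup S]
    [AddCommGroup R] [Module k R] [AddCommGroup V] [Module k V]
    (lam : k) (A : RBFData k S R) (D : ExtDatum k S R V) : Prop :=
  IsRBFOps lam (natMul A D) (natP A D) (natTheta A D)

/-- The Rota-Baxter family Hom-associative axioms can be pulled back along an injective linear
map that intertwines all the operations. -/
theorem IsRBFOps.of_injective {k S M N : Type*} [Field k] [Semigroup S]
    [AddCommGroup M] [Module k M] [AddCommGroup N] [Module k N] {lam : k}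
    {mul : M → M → M} {P : S → M → M} {theta : M → M}
    {mul' : N → N → N} {P' : S → N → N} {theta' : N → N}
    (h : IsRBFOps lam mul' P' theta') (g : M →ₗ[k] N) (hg : Function.Injective g)
    (hmul : ∀ x y, g (mul x y) = mul' (g x) (g y))
    (hP : ∀ ω x, g (P ω x) = P' ω (g x))
    (htheta : ∀ x, g (theta x) = theta' (g x)) :
    IsRBFOps lam mul P theta := by
  obtain ⟨hassoc, hRB, hcomm⟩ := h
  refine ⟨fun x y z => hg ?_, fun α β x y => hg ?_, fun ω x => hg ?_⟩
  · simp only [hmul, htheta, hassoc]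
  · simp only [hmul, hP, map_add, map_smul, hRB]
  · simp only [hP, htheta, hcomm]

/-- Proposition 4.2: if `d : V → R` is a deformation map of a Rota-Baxter family
Hom extending structure `Ω(R,V)` of `R` through `V`, then
`V_d := (V, ·_d, (P_{ω,V}), θ_V)` with `x ·_d y := x ·_V y + d(x)▷y + x◁d(y)` is a
Rota-Baxter family Hom-associative algebra of weight `lam` (the deformation of `V`). -/
theorem stmt13 {k S R V : Type*} [Field k] [Semigroup S]
    [AddCommGroup R] [Module k R] [AddCommGroup V] [Module k V]
    (lam : k) (A : RBFData k S R) (hA : A.IsRBF lam)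
    (D : ExtDatum k S R V) (hD : IsExtendingStructure lam A D)
    (d : V →ₗ[k] R)
    -- d is a deformation map:
    (hd1 : ∀ x y : V,
      A.mul (d x) (d y) - d (D.mulV x y)
        = d (D.dR (d x) y + D.dL x (d y)) - D.hL (d x) y - D.hR x (d y) - D.f x y)
    (hd2 : ∀ (ω : S) (x : V), d (D.PV ω x) = D.Q ω x + A.P ω (d x))
    (hd3 : ∀ x : V, d (D.thetaV x) = D.eta x + A.theta (d x)) :
    IsRBFOps lam (fun x y => D.mulV x y + D.dR (d x) y + D.dL x (d y))
      (fun ω x => D.PV ω x) (fun x => D.thetaV x) := by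
  refine hD.of_injective (d.prod LinearMap.id) (fun x y h => congrArg Prod.snd h)
    (fun x y => Prod.ext ?_ ?_) (fun ω x => Prod.ext ?_ rfl) (fun x => Prod.ext ?_ rfl)
  · have h := hd1 x y
    simp only [map_add] at h
    simp only [natMul, LinearMap.prod_apply, Function.prod, LinearMap.id_apply, map_add,
      Prod.fst_add]
    linear_combination (norm := module) -h
  · simp only [natMul, LinearMap.prod_apply, Function.prod, LinearMap.id_apply]
    abel
  · simp only [natP, LinearMap.prod_apply, Function.prod, LinearMap.id_apply, hd2]
    abel
  · simp only [natTheta, LinearMap.prod_apply, Function.prod, LinearMap.id_apply, hd3]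
    abel
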